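/- arXiv:0807.2330 — 3 statements merged into one kernel-verified Lean document; each statement's English description precedes it below -/
import Mathlib

section
/- Let G be a finite acyclic digraph with exactly one source s and exactly one sink t. If G does not have a Hamiltonian path, then there exist two distinct vertices u and v of G such that u is not reachable from v and v is not reachable from u (i.e., they are not connected by a directed path in either direction). -/
/-- In an acyclic relation, if a list of all elements is ordered by the transitive closure, then
consecutive elements are related. -/
theorem isChain_of_pairwise_transGen {V : Type*} {E : V → V → Prop}
    (hacyc : ∀ x, ¬ Relation.TransGen E x x) {l : List V}
    (hl : l.Pairwise (Relation.TransGen E)) (hmem : ∀ x, x ∈ l) : l.IsChain E := by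
  refine List.isChain_iff_forall_rel_of_append_cons_cons.mpr fun {a b l₁ l₂} h => ?_
  subst h
  simp only [List.pairwise_append, List.pairwise_cons, List.mem_cons] at hl
  obtain ⟨-, ⟨ha, hb, -⟩, hl₁⟩ := hl
  obtain ⟨c, hac, hcb⟩ := Relation.TransGen.head'_iff.mp (ha b (.inl rfl))
  have hc := hmem c
  simp only [List.mem_append, List.mem_cons] at hc
  rcases hc with hc | rfl | rfl | hc
  · exact (hacyc a (.head hac (hl₁ c hc a (.inl rfl)))).elim
  · exact (hacyc c (.single hac)).elim
  · exact hac
  · exact (hacyc b ((hb c hc).trans_left hcb)).elim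

/-- A finite acyclic relation with total reachability has a Hamiltonian path. -/
theorem exists_hamiltonian_of_total_reflTransGen {V : Type*} [Finite V] {E : V → V → Prop}
    (hacyc : ∀ x, ¬ Relation.TransGen E x x)
    (htot : ∀ u v, Relation.ReflTransGen E u v ∨ Relation.ReflTransGen E v u) :
    ∃ l : List V, l.IsChain E ∧ l.Nodup ∧ ∀ x, x ∈ l := by
  classical
  have := Fintype.ofFinite V
  have : Std.Total (Relation.ReflTransGen E) := ⟨htot⟩
  let l := (Finset.univ : Finset V).toList.insertionSort (Relation.ReflTransGen E)
  have hmem : ∀ x, x ∈ l := by simp [l]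
  have hnodup : l.Nodup :=
    (List.perm_insertionSort _ _).nodup_iff.mpr (Finset.nodup_toList _)
  have hpair : l.Pairwise (Relation.TransGen E) :=
    (List.pairwise_insertionSort _ _).imp₂ (fun a b hab hne =>
      (Relation.reflTransGen_iff_eq_or_transGen.mp hab).resolve_left (Ne.symm hne)) hnodup
  exact ⟨l, isChain_of_pairwise_transGen hacyc hpair hmem, hnodup, hmem⟩


/-- **Lemma 2.** Let `G` be a finite acyclic digraph (edge relation `E`) with exactly one
source `s` and exactly one sink `t`.  If `G` has no Hamiltonian path (a list of vertices
containing every vertex exactly once, with consecutive vertices joined by edges),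
then there exist two distinct vertices `u` and `v` that are not connected by a directed
path in either direction (reachability being the reflexive-transitive closure of `E`). -/
theorem acyclic_st_digraph_no_hamiltonian_path_exists_incomparable_pair
    {V : Type*} [Fintype V] (E : V → V → Prop)
    (hacyc : ∀ x : V, ¬ Relation.TransGen E x x)
    (s t : V)
    (hs_source : ∀ u : V, ¬ E u s)
    (hs_uniq : ∀ v : V, (∀ u : V, ¬ E u v) → v = s)
    (ht_sink : ∀ u : V, ¬ E t u)
    (ht_uniq : ∀ v : V, (∀ u : V, ¬ E v u) → v = t)
    (hnoham : ¬ ∃ l : List V, l.Chain' E ∧ l.Nodup ∧ ∀ x : V, x ∈ l) :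
    ∃ u v : V, u ≠ v ∧ ¬ Relation.ReflTransGen E u v ∧ ¬ Relation.ReflTransGen E v u := by
  by_contra! h
  refine hnoham (exists_hamiltonian_of_total_reflTransGen hacyc fun u v => ?_)
  by_cases huv : u = v
  · exact .inl (huv ▸ .refl)
  · exact or_iff_not_imp_left.mpr (h u v huv)
end

section
/- Let G be a finite acyclic digraph, let P = (p_0, p_1, …, p_k) be a directed path from s = p_0 to t = p_k, let a be a vertex not lying on P, and let 0 ≤ i < k. Suppose there is a directed path from p_i to a all of whose vertices except p_i avoid P, and a directed path from a to p_{i+1} all of whose vertices except p_{i+1} avoid P. Then G contains a directed path from s to t that is strictly longer than P (it visits strictly more than k+1 vertices); in particular P is not a maximum-length directed path from s to t. -/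
/-- Directed paths sharing an endpoint can be concatenated. -/
theorem List.IsChain.exists_join {V : Type*} {E : V → V → Prop} {l m : List V} {x y z : V}
    (hl : l.IsChain E) (hlx : l.head? = some x) (hly : l.getLast? = some y)
    (hm : m.IsChain E) (hmy : m.head? = some y) (hmz : m.getLast? = some z) :
    ∃ r : List V, r.IsChain E ∧ r.head? = some x ∧ r.getLast? = some z ∧
      r.length + 1 = l.length + m.length := by
  obtain ⟨m', rfl⟩ := List.head?_eq_some_iff.mp hmy
  refine ⟨l ++ m', List.isChain_append.mpr ⟨hl, hm.tail, fun u hu v hv => ?_⟩, ?_, ?_, ?_⟩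
  · obtain rfl : y = u := by simpa [hly] using hu
    exact (List.isChain_cons.mp hm).1 v hv
  · simp [List.head?_append, hlx]
  · cases m' with
    | nil => simp_all
    | cons b m' => simp_all [List.getLast?_append, List.getLast?_cons_cons]
  · simp [Nat.add_assoc]

/-- A directed path between distinct vertices has at least two vertices. -/
theorem List.two_le_length_of_head?_of_getLast? {V : Type*} {l : List V} {x y : V}
    (hx : l.head? = some x) (hy : l.getLast? = some y) (hxy : x ≠ y) : 2 ≤ l.length := by
  match l with
  | [] => simp at hx
  | [b] => simp_all
  | _ :: _ :: _ => simp

/-- A directed path in an acyclic digraph does not repeat a vertex. -/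
theorem List.IsChain.nodup_of_acyclic {V : Type*} {E : V → V → Prop} {l : List V}
    (hl : l.IsChain E) (hacyc : ∀ x, ¬ Relation.TransGen E x x) : l.Nodup :=
  (hl.imp fun _ _ => Relation.TransGen.single).pairwise.imp (S := (· ≠ ·))
    fun {x y} h (hxy : x = y) => hacyc x (by rwa [← hxy] at h)


/-- **Path-extension claim (from the proof of Lemma 2).** Let `E` be the edge relation of
a finite acyclic digraph, let `P = (p 0, p 1, …, p k)` be a directed path from
`s = p 0` to `t = p k`, let `a` be a vertex not lying on `P`, and let `i < k`.
Suppose there is a directed path `q₁` from `p i` to `a` all of whose vertices except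
`p i` avoid `P`, and a directed path `q₂` from `a` to `p (i+1)` all of whose vertices
except `p (i+1)` avoid `P`.  Then the digraph contains a directed path from `s` to `t`
that visits strictly more than `k + 1` distinct vertices; in particular `P` is not a
maximum-length directed path from `s` to `t`. -/
theorem acyclic_digraph_detour_yields_longer_path
    {V : Type*} [Fintype V] (E : V → V → Prop)
    (hacyc : ∀ x : V, ¬ Relation.TransGen E x x)
    (k : ℕ) (p : Fin (k + 1) → V)
    (hp : ∀ i : Fin k, E (p i.castSucc) (p i.succ))
    (a : V) (ha : ∀ j : Fin (k + 1), p j ≠ a)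
    (i : Fin k)
    (q₁ : List V)
    (hq₁chain : q₁.Chain' E)
    (hq₁head : q₁.head? = some (p i.castSucc))
    (hq₁last : q₁.getLast? = some a)
    (hq₁avoid : ∀ x ∈ q₁.tail, ∀ j : Fin (k + 1), p j ≠ x)
    (q₂ : List V)
    (hq₂chain : q₂.Chain' E)
    (hq₂head : q₂.head? = some a)
    (hq₂last : q₂.getLast? = some (p i.succ))
    (hq₂avoid : ∀ x ∈ q₂.dropLast, ∀ j : Fin (k + 1), p j ≠ x) :
    ∃ r : List V, r.Chain' E ∧ r.Nodup ∧
      r.head? = some (p 0) ∧ r.getLast? = some (p (Fin.last k)) ∧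
      k + 1 < r.length := by
  have hL : (List.ofFn p).IsChain E :=
    List.isChain_iff_getElem.mpr fun j hj => by
      simpa [-List.ofFn_succ, Fin.castSucc, Fin.castAdd, Fin.castLE, Fin.succ] using
        hp ⟨j, by simpa using hj⟩
  have hi := i.isLt
  have htake : ((List.ofFn p).take (i + 1)).IsChain E := hL.take _
  have hdrop : ((List.ofFn p).drop (i + 1)).IsChain E := hL.drop _
  obtain ⟨r₁, hr₁, hr₁head, hr₁last, hr₁len⟩ := htake.exists_join
    (x := p 0) (by simp)
    (y := p i.castSucc) (by
      rw [List.getLast?_take]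
      simp [-List.ofFn_succ, Nat.lt_succ_of_lt hi, Fin.castSucc, Fin.castAdd, Fin.castLE])
    hq₁chain hq₁head hq₁last
  obtain ⟨r₂, hr₂, hr₂head, hr₂last, hr₂len⟩ :=
    hr₁.exists_join hr₁head hr₁last hq₂chain hq₂head hq₂last
  obtain ⟨r, hr, hrhead, hrlast, hrlen⟩ := hr₂.exists_join hr₂head hr₂last hdrop
    (by simp [List.head?_drop, hi, Fin.succ])
    (z := p (Fin.last k)) (by
      rw [List.getLast?_drop, List.getLast?_eq_getElem?]
      simp [-List.ofFn_succ, hi, Fin.last])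
  have h₁ := List.two_le_length_of_head?_of_getLast? hq₁head hq₁last (ha _)
  have h₂ := List.two_le_length_of_head?_of_getLast? hq₂head hq₂last (ha _).symm
  refine ⟨r, hr, hr.nodup_of_acyclic hacyc, hrhead, hrlast, ?_⟩
  simp only [List.length_take, List.length_drop, List.length_ofFn] at hr₁len hrlen
  omega
end

section
/- Let G = (V, E) be a finite acyclic digraph with |V| = n ≥ 1. Then the minimum, over all linear extensions (v_1, …, v_n) of G, of the number of jumps of the extension (consecutive pairs (v_i, v_{i+1}) such that neither vertex is reachable from the other) equals the minimum cardinality of an acyclic HP-completion set for G. -/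
open Relation

/-- In an enumeration whose consecutive entries are related by `R`, earlier entries are joined
to later ones by a directed `R`-path. -/
theorem transGen_of_consecutive {V : Type*} {R : V → V → Prop} {n : ℕ} {v : Fin n → V}
    (hv : ∀ (i : ℕ) (h : i + 1 < n), R (v ⟨i, by omega⟩) (v ⟨i + 1, h⟩))
    (i j : Fin n) (hij : i < j) : TransGen R (v i) (v j) := by
  obtain ⟨i, hi⟩ := i
  obtain ⟨j, hj⟩ := j
  have hij : i + 1 ≤ j := hij
  induction j, hij using Nat.le_induction with
  | base => exact .single (hv i hj)
  | succ k hk ih => exact (ih (by omega) hk).tail (hv k hj)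

/-- If `b` is the successor of `a` in a linear extension and `b` is reachable from `a`, then
`a → b` is an edge. -/
theorem edge_of_reachable_succ {V : Type*} {E : V → V → Prop}
    (hacyc : ∀ x : V, ¬ TransGen E x x) {n : ℕ} {v : Fin n → V} (hv : Function.Bijective v)
    (hext : ∀ i j : Fin n, ReflTransGen E (v i) (v j) → i ≤ j)
    {i j : Fin n} (hij : (j : ℕ) = i + 1) (h : ReflTransGen E (v i) (v j)) :
    E (v i) (v j) := by
  rcases h.cases_head with h | ⟨c, hc, hcj⟩
  · have := congrArg Fin.val (hv.1 h)
    omega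
  · obtain ⟨k, rfl⟩ := hv.2 c
    have hik : (i : ℕ) ≤ k := hext i k (.single hc)
    have hkj : (k : ℕ) ≤ j := hext k j hcj
    have hne : (i : ℕ) ≠ k := fun h => hacyc (v i) (by
      obtain rfl : i = k := Fin.ext h
      exact .single hc)
    obtain rfl : k = j := Fin.ext (by omega)
    exact hc

/-- A linear extension yields an acyclic HP-completion set whose elements are its jumps. -/
theorem exists_completion_of_linear_extension {V : Type*} {E : V → V → Prop}
    (hacyc : ∀ x : V, ¬ TransGen E x x) {n : ℕ} {v : Fin n → V} (hv : Function.Bijective v)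
    (hext : ∀ i j : Fin n, ReflTransGen E (v i) (v j) → i ≤ j) :
    ∃ Ec : Set (V × V),
      (∀ x : V, ¬ TransGen (fun a b => E a b ∨ (a, b) ∈ Ec) x x) ∧
      (∃ l : List V, l.IsChain (fun a b => E a b ∨ (a, b) ∈ Ec) ∧ l.Nodup ∧ ∀ x : V, x ∈ l) ∧
      Nat.card Ec = Nat.card {i : Fin n // ∃ h : (i : ℕ) + 1 < n,
        ¬ ReflTransGen E (v i) (v ⟨(i : ℕ) + 1, h⟩) ∧
        ¬ ReflTransGen E (v ⟨(i : ℕ) + 1, h⟩) (v i)} := by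
  let f : {i : Fin n // ∃ h : (i : ℕ) + 1 < n,
      ¬ ReflTransGen E (v i) (v ⟨(i : ℕ) + 1, h⟩) ∧
      ¬ ReflTransGen E (v ⟨(i : ℕ) + 1, h⟩) (v i)} → V × V :=
    fun i => (v i, v ⟨(i : ℕ) + 1, i.2.1⟩)
  have hf : Function.Injective f := fun i j h => Subtype.ext (hv.1 (congrArg Prod.fst h))
  refine ⟨Set.range f, fun x hx => ?_, ⟨List.ofFn v, ?_, List.nodup_ofFn.2 hv.1, fun x => ?_⟩,
    Nat.card_range_of_injective hf⟩
  · have key : ∀ i j : Fin n, (E (v i) (v j) ∨ (v i, v j) ∈ Set.range f) → i < j := by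
      rintro i j (h | ⟨k, hk⟩)
      · refine lt_of_le_of_ne (hext i j (.single h)) ?_
        rintro rfl
        exact hacyc _ (.single h)
      · have h₁ : k.1 = i := hv.1 (congrArg Prod.fst hk)
        have h₂ : (⟨(k : ℕ) + 1, k.2.1⟩ : Fin n) = j := hv.1 (congrArg Prod.snd hk)
        rw [← h₁, ← h₂, Fin.lt_def]
        exact Nat.lt_succ_self _
    let e := Equiv.ofBijective v hv
    have hlt : TransGen (· < ·) (e.symm x) (e.symm x) :=
      hx.lift e.symm fun a b hab => key _ _ (by
        simpa only [← Equiv.ofBijective_apply v hv, e, Equiv.apply_symm_apply] using hab)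
    exact lt_irrefl _ (transGen_eq_self (r := ((· < ·) : Fin n → Fin n → Prop)) ▸ hlt)
  · rw [List.isChain_iff_getElem]
    intro i hi
    have hi' : i + 1 < n := by simpa using hi
    simp only [List.getElem_ofFn]
    by_cases h : ReflTransGen E (v ⟨i, by omega⟩) (v ⟨i + 1, hi'⟩)
    · exact .inl (edge_of_reachable_succ hacyc hv hext rfl h)
    · refine .inr ⟨⟨⟨i, by omega⟩, hi', h, fun h' => ?_⟩, rfl⟩
      have := Fin.le_def.1 (hext _ _ h')
      simp at this
  · rw [List.mem_ofFn]
    exact hv.2 x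

/-- A Hamiltonian path of an acyclic completion is a linear extension whose number of jumps is
at most the size of the completion set. -/
theorem exists_linear_extension_of_completion {V : Type*} [Fintype V] {E : V → V → Prop}
    {n : ℕ} (hcard : Fintype.card V = n) {Ec : Set (V × V)}
    (hacyc : ∀ x : V, ¬ TransGen (fun a b => E a b ∨ (a, b) ∈ Ec) x x) {l : List V}
    (hl : l.IsChain (fun a b => E a b ∨ (a, b) ∈ Ec)) (hnd : l.Nodup) (hmem : ∀ x : V, x ∈ l) :
    ∃ v : Fin n → V, Function.Bijective v ∧
      (∀ i j : Fin n, ReflTransGen E (v i) (v j) → i ≤ j) ∧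
      Nat.card {i : Fin n // ∃ h : (i : ℕ) + 1 < n,
        ¬ ReflTransGen E (v i) (v ⟨(i : ℕ) + 1, h⟩) ∧
        ¬ ReflTransGen E (v ⟨(i : ℕ) + 1, h⟩) (v i)} ≤ Nat.card Ec := by
  classical
  have hlen : l.length = n := by
    rw [← hcard, ← List.toFinset_card_of_nodup hnd,
      Finset.eq_univ_of_forall fun x => List.mem_toFinset.2 (hmem x), Finset.card_univ]
  subst hlen
  have hstep := List.isChain_iff_getElem.1 hl
  have hinj : Function.Injective l.get := List.nodup_iff_injective_get.1 hnd
  refine ⟨l.get, ⟨hinj, fun x => List.get_of_mem (hmem x)⟩, fun i j hij => ?_, ?_⟩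
  · by_contra! hji
    exact hacyc _ ((transGen_of_consecutive (v := l.get) hstep j i hji).trans_left
      (ReflTransGen.mono (fun _ _ => Or.inl) _ _ hij))
  · refine Nat.card_le_card_of_injective
      (fun i => (⟨(l.get i.1, l.get ⟨(i.1 : ℕ) + 1, i.2.1⟩), ?_⟩ : Ec)) fun i j h => ?_
    · obtain ⟨h, h₁, -⟩ := i.2
      exact (hstep _ h).resolve_left fun he => h₁ (.single he)
    · exact Subtype.ext (hinj (congrArg (fun p : Ec => p.1.1) h))


/-- **Jump number = minimum acyclic HP-completion size.** Let `E` be the edge relation of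
a finite acyclic digraph on `n ≥ 1` vertices.  A *linear extension* is a bijective
enumeration `v : Fin n → V` of the vertices such that whenever `v j` is reachable from
`v i` one has `i ≤ j`; a consecutive pair `(v i, v (i+1))` is a *jump* if neither vertex
is reachable from the other.  An *acyclic HP-completion set* is a set `Ec` of ordered
pairs of vertices such that the digraph with edge relation `E ∪ Ec` is acyclic and has
a Hamiltonian path.  Then the minimum number of jumps over all linear extensions equals
the minimum cardinality of an acyclic HP-completion set. -/
theorem jump_number_eq_min_acyclic_hp_completion_card
    {V : Type*} [Fintype V] (E : V → V → Prop)
    (hacyc : ∀ x : V, ¬ Relation.TransGen E x x)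
    (n : ℕ) (hcard : Fintype.card V = n) (hn : 1 ≤ n) :
    sInf {m : ℕ | ∃ v : Fin n → V, Function.Bijective v ∧
        (∀ i j : Fin n, Relation.ReflTransGen E (v i) (v j) → i ≤ j) ∧
        Nat.card {i : Fin n // ∃ h : (i : ℕ) + 1 < n,
          ¬ Relation.ReflTransGen E (v i) (v ⟨(i : ℕ) + 1, h⟩) ∧
          ¬ Relation.ReflTransGen E (v ⟨(i : ℕ) + 1, h⟩) (v i)} = m}
    = sInf {m : ℕ | ∃ Ec : Set (V × V),
        (∀ x : V, ¬ Relation.TransGen (fun a b => E a b ∨ (a, b) ∈ Ec) x x) ∧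
        (∃ l : List V, l.Chain' (fun a b => E a b ∨ (a, b) ∈ Ec) ∧ l.Nodup ∧
          ∀ x : V, x ∈ l) ∧
        Nat.card Ec = m} := by
  set A := {m : ℕ | ∃ v : Fin n → V, _}
  set B := {m : ℕ | ∃ Ec : Set (V × V), _}
  have hAB : A ⊆ B := by
    rintro m ⟨v, hv, hext, rfl⟩
    exact exists_completion_of_linear_extension hacyc hv hext
  have hBA : ∀ b ∈ B, ∃ a ∈ A, a ≤ b := by
    rintro b ⟨Ec, hEc, ⟨l, hl, hnd, hmem⟩, rfl⟩
    obtain ⟨v, hv, hext, hle⟩ := exists_linear_extension_of_completion hcard hEc hl hnd hmem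
    exact ⟨_, ⟨v, hv, hext, rfl⟩, hle⟩
  rcases B.eq_empty_or_nonempty with hB | hB
  · have hA : A = ∅ := Set.subset_empty_iff.1 (hAB.trans hB.subset)
    rw [hA, hB]
  · obtain ⟨a, ha, hle⟩ := hBA _ (Nat.sInf_mem hB)
    exact le_antisymm ((Nat.sInf_le ha).trans hle) (Nat.sInf_le (hAB (Nat.sInf_mem ⟨a, ha⟩)))
end
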